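/- Let k, s, t be positive integers with k ≥ 3 and k ≤ s − 1. Suppose that every set of s − 1 points in general position in the plane contains at least one k-hole (i.e., X_k(s−1) ≥ 1), and that every set of s points in general position in the plane contains at least t k-holes (i.e., X_k(s) ≥ t). Then for every integer n ≥ 2s − 2, every set of n points in general position in the plane contains at least ((t+1)/(s−k+1))·(n − (2s−2)) k-holes, i.e., X_k(n) ≥ ((t+1)/(s−k+1))·(n − (2s−2)). -/

import Mathlib

open scoped Classical

noncomputable section

/-- A point in the plane. -/
abbrev Pt := ℝ × ℝ

/-- A finite point set is in general position if no three of its points are collinear. -/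
def GenPos (P : Finset Pt) : Prop :=
  ∀ S ⊆ P, S.card = 3 → ¬ Collinear ℝ (S : Set Pt)

/-- A finite set is in convex position (its points are vertices of a convex polygon)
if no point lies in the convex hull of the others. -/
def ConvexPos (S : Finset Pt) : Prop :=
  ∀ x ∈ S, x ∉ convexHull ℝ ((S : Set Pt) \ {x})

/-- `S` is a `k`-hole of `P`: a `k`-element subset of `P` in convex position whose
convex hull contains no point of `P \ S`. -/
def IsHole (k : ℕ) (P S : Finset Pt) : Prop :=
  S ⊆ P ∧ S.card = k ∧ ConvexPos S ∧
    ∀ p ∈ P, p ∈ convexHull ℝ (S : Set Pt) → p ∈ S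

/-- The number of `k`-holes of `P`. -/
def numHoles (k : ℕ) (P : Finset Pt) : ℕ :=
  (P.powerset.filter (fun S => IsHole k P S)).card

/-- `p` lies strictly to the left of the line through `x` and `y`, oriented from `x` to `y`. -/
def leftOf (x y p : Pt) : Prop :=
  0 < (y.1 - x.1) * (p.2 - x.2) - (y.2 - x.2) * (p.1 - x.1)

/-- `(x, y)` is a `j`-edge of `P`: `x, y` are distinct points of `P` and exactly `j`
points of `P` lie strictly to the left of the oriented line `xy`. -/
def IsJEdge (j : ℕ) (P : Finset Pt) (x y : Pt) : Prop :=
  x ∈ P ∧ y ∈ P ∧ x ≠ y ∧ (P.filter (fun p => leftOf x y p)).card = j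

/-- Some line strictly separates `A` from `B`. -/
def SepByLine (A B : Set Pt) : Prop :=
  ∃ u : Pt, u ≠ 0 ∧ ∃ c : ℝ,
    (∀ p ∈ A, u.1 * p.1 + u.2 * p.2 < c) ∧ (∀ q ∈ B, c < u.1 * q.1 + u.2 * q.2)

/-- linear functional -/
def lf (u p : Pt) : ℝ := u.1 * p.1 + u.2 * p.2

lemma lf_neg (u p : Pt) : lf (-u) p = - lf u p := by simp [lf]; ring

lemma lf_cont (p : Pt) : Continuous (fun u : Pt => lf u p) := by unfold lf; fun_prop

lemma lf_collinear {u : Pt} (hu : u ≠ 0) (s : Set Pt) (x : Pt)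
    (h : ∀ p ∈ s, lf u p = lf u x) : Collinear ℝ s := by
  rw [collinear_iff_exists_forall_eq_smul_vadd]
  have hpos : u.1 ^ 2 + u.2 ^ 2 ≠ 0 := by
    intro h0
    apply hu
    have h1 : u.1 = 0 := by nlinarith [sq_nonneg u.1, sq_nonneg u.2]
    have h2 : u.2 = 0 := by nlinarith [sq_nonneg u.1, sq_nonneg u.2]
    exact Prod.ext h1 h2
  refine ⟨x, (-u.2, u.1), fun p hp => ?_⟩
  have e := h p hp
  unfold lf at e
  refine ⟨(-u.2 * (p.1 - x.1) + u.1 * (p.2 - x.2)) / (u.1 ^ 2 + u.2 ^ 2), ?_⟩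
  apply Prod.ext
  · simp
    field_simp
    linear_combination u.1 * e
  · simp
    field_simp
    linear_combination u.2 * e

lemma genpos_line {P : Finset Pt} (hP : GenPos P) {u : Pt} (hu : u ≠ 0) {x y z : Pt}
    (hx : x ∈ P) (hy : y ∈ P) (hz : z ∈ P) (hxy : x ≠ y) (hxz : x ≠ z)
    (e1 : lf u y = lf u x) (e2 : lf u z = lf u x) : y = z := by
  by_contra hyz
  refine hP {x, y, z} ?_ ?_ (lf_collinear hu _ x ?_)
  · intro p hp
    simp at hp
    rcases hp with rfl | rfl | rfl <;> assumption
  · rw [Finset.card_eq_three]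
    exact ⟨x, y, z, hxy, hxz, hyz, rfl⟩
  · intro p hp
    simp at hp
    rcases hp with rfl | rfl | rfl
    · rfl
    · exact e1
    · exact e2

lemma GenPos.mono {P Q : Finset Pt} (hP : GenPos P) (h : Q ⊆ P) : GenPos Q :=
  fun S hS hc => hP S (hS.trans h) hc

lemma key {P : Finset Pt} (hP : GenPos P) {u : Pt} (hu : u ≠ 0) {x : Pt} (hx : x ∈ P)
    {A : Finset Pt} (hA : A ⊆ P) (hxA : x ∉ A) (h : ∀ a ∈ A, lf u x ≤ lf u a) :
    x ∉ convexHull ℝ (A : Set Pt) := by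
  intro hmem
  have hne : A.Nonempty := by
    rw [Finset.nonempty_iff_ne_empty]
    rintro rfl
    simp at hmem
  obtain ⟨q, hqA, hq⟩ : ∃ q ∈ A, ∀ a ∈ A, lf u x < lf u a ∨ a = q := by
    by_cases h0 : ∃ q ∈ A, lf u q = lf u x
    · obtain ⟨q, hqA, hq⟩ := h0
      refine ⟨q, hqA, fun a ha => ?_⟩
      rcases (h a ha).lt_or_eq with h1 | h1
      · exact Or.inl h1
      · right
        exact genpos_line hP hu hx (hA ha) (hA hqA) (fun e => hxA (e ▸ ha))
          (fun e => hxA (e ▸ hqA)) h1.symm hq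
    · push Not at h0
      obtain ⟨q, hqA⟩ := hne
      exact ⟨q, hqA, fun a ha => Or.inl (lt_of_le_of_ne (h a ha) (Ne.symm (h0 a ha)))⟩
  have hxq : x ≠ q := fun e => hxA (e ▸ hqA)
  have hq0 := h q hqA
  have hconv : Convex ℝ {p : Pt | lf u x < lf u p ∨ p = q} := by
    intro a ha b hb α β hα hβ hαβ
    have hlin : lf u (α • a + β • b) = α * lf u a + β * lf u b := by
      simp [lf]; ring
    have ha' : lf u x ≤ lf u a := by
      rcases ha with h | h
      · exact h.le
      · rw [h]; exact hq0
    have hb' : lf u x ≤ lf u b := by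
      rcases hb with h | h
      · exact h.le
      · rw [h]; exact hq0
    rcases hα.lt_or_eq with hα' | hα'
    · rcases hβ.lt_or_eq with hβ' | hβ'
      · rcases ha with ha | ha
        · left
          rw [hlin]
          have : α = 1 - β := by linarith
          subst this
          nlinarith [mul_lt_mul_of_pos_left ha hα', mul_le_mul_of_nonneg_left hb' hβ]
        · rcases hb with hb | hb
          · left
            rw [hlin]
            have : α = 1 - β := by linarith
            subst this
            nlinarith [mul_lt_mul_of_pos_left hb hβ', mul_le_mul_of_nonneg_left ha' hα]
          · right
            rw [ha, hb, ← add_smul, hαβ, one_smul]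
      · have : α = 1 := by linarith
        subst hβ'
        subst this
        simpa using ha
    · have : β = 1 := by linarith
      subst hα'
      subst this
      simpa using hb
  have := convexHull_min (s := (A : Set Pt)) (fun a ha => hq a ha) hconv hmem
  rcases this with h | h
  · exact lt_irrefl _ h
  · exact hxq h

/-- holes of a cut are holes -/
lemma hole_lift {k : ℕ} {P Q S : Finset Pt} (hQ : Q ⊆ P) (hS : IsHole k Q S)
    (h : ∀ x ∈ P, x ∉ Q → x ∉ convexHull ℝ (S : Set Pt)) : IsHole k P S := by
  obtain ⟨a, b, c, d⟩ := hS
  refine ⟨a.trans hQ, b, c, fun p hp hpS => ?_⟩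
  by_cases hpQ : p ∈ Q
  · exact d p hpQ hpS
  · exact absurd hpS (h p hp hpQ)

lemma hole_lift_cut {k : ℕ} {P Q S : Finset Pt} (hP : GenPos P) {u : Pt} (hu : u ≠ 0)
    (hQ : Q ⊆ P) (hS : IsHole k Q S)
    (h : ∀ x ∈ P, x ∉ Q → ∀ q ∈ Q, lf u q ≤ lf u x) : IsHole k P S := by
  refine hole_lift hQ hS fun x hx hxQ => ?_
  refine key hP (neg_ne_zero.mpr hu) hx (hS.1.trans hQ) (fun e => hxQ (hS.1 e)) ?_
  intro a ha
  rw [lf_neg, lf_neg]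
  exact neg_le_neg (h x hx hxQ a (hS.1 ha))

lemma exists_first (f : Pt → ℝ) (C : Finset Pt) : ∀ m, m ≤ C.card →
    ∃ R ⊆ C, R.card = m ∧ ∀ r ∈ R, ∀ p ∈ C, p ∉ R → f r ≤ f p := by
  intro m
  induction m with
  | zero => intro _; exact ⟨∅, by simp, rfl, by simp⟩
  | succ m ih =>
    intro hm
    obtain ⟨R, hRC, hRm, hR⟩ := ih (by omega)
    have hne : (C \ R).Nonempty := by
      rw [← Finset.card_pos, Finset.card_sdiff_of_subset hRC]; omega
    obtain ⟨x, hx, hmin⟩ := Finset.exists_min_image (C \ R) f hne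
    rw [Finset.mem_sdiff] at hx
    refine ⟨insert x R, ?_, ?_, ?_⟩
    · intro p hp
      rcases Finset.mem_insert.mp hp with rfl | hp
      · exact hx.1
      · exact hRC hp
    · rw [Finset.card_insert_of_notMem hx.2, hRm]
    · intro r hr p hp hpR
      rw [Finset.mem_insert, not_or] at hpR
      rcases Finset.mem_insert.mp hr with rfl | hr
      · exact hmin p (Finset.mem_sdiff.mpr ⟨hp, hpR.2⟩)
      · exact hR r hr p hp hpR.2

lemma exists_generic (P : Finset Pt) : ∃ u : Pt, u ≠ 0 ∧
    ∀ p ∈ P, ∀ q ∈ P, lf u p = lf u q → p = q := by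
  obtain ⟨m, hm⟩ := Infinite.exists_notMem_finset
    ((P ×ˢ P).image (fun z => - (z.1.1 - z.2.1) / (z.1.2 - z.2.2)))
  refine ⟨(1, m), by simp, fun p hp q hq h => ?_⟩
  simp only [lf, one_mul] at h
  by_cases h2 : p.2 = q.2
  · rw [h2] at h
    exact Prod.ext (by linarith) h2
  · exfalso
    apply hm
    rw [Finset.mem_image]
    refine ⟨(p, q), Finset.mem_product.mpr ⟨hp, hq⟩, ?_⟩
    have : p.2 - q.2 ≠ 0 := sub_ne_zero.mpr h2
    field_simp
    linarith

/-- points of `D` not above all of `S` -/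
def cM (S D : Finset Pt) (u : Pt) : Finset Pt := D.filter (fun p => ∃ a ∈ S, lf u p ≤ lf u a)
def cL (S D : Finset Pt) (u : Pt) : Finset Pt := D.filter (fun p => ∃ a ∈ S, lf u p < lf u a)

lemma open_L (S D : Finset Pt) (m : ℕ) : IsOpen {u : Pt | m ≤ (cL S D u).card} := by
  rw [isOpen_iff_mem_nhds]
  intro u hu
  have : ∀ᶠ v in nhds u, ∀ p ∈ cL S D u, p ∈ cL S D v := by
    rw [Filter.eventually_all_finset]
    intro p hp
    obtain ⟨hpD, a, ha, hlt⟩ := Finset.mem_filter.mp hp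
    filter_upwards [(isOpen_lt (lf_cont p) (lf_cont a)).mem_nhds hlt] with v hv
    exact Finset.mem_filter.mpr ⟨hpD, a, ha, hv⟩
  filter_upwards [this] with v hv
  exact le_trans hu (Finset.card_le_card hv)

lemma open_M (S D : Finset Pt) (m : ℕ) : IsOpen {u : Pt | (cM S D u).card ≤ m} := by
  rw [isOpen_iff_mem_nhds]
  intro u hu
  have : ∀ᶠ v in nhds u, ∀ p ∈ D \ cM S D u, p ∉ cM S D v := by
    rw [Filter.eventually_all_finset]
    intro p hp
    rw [Finset.mem_sdiff] at hp
    have h0 : ∀ a ∈ S, lf u a < lf u p := by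
      intro a ha
      by_contra hc
      exact hp.2 (Finset.mem_filter.mpr ⟨hp.1, a, ha, not_lt.mp hc⟩)
    have : ∀ᶠ v in nhds u, ∀ a ∈ S, lf v a < lf v p := by
      rw [Filter.eventually_all_finset]
      intro a ha
      exact (isOpen_lt (lf_cont a) (lf_cont p)).mem_nhds (h0 a ha)
    filter_upwards [this] with v hv hmem
    obtain ⟨_, a, ha, hle⟩ := Finset.mem_filter.mp hmem
    exact absurd (hv a ha) (not_lt.mpr hle)
  filter_upwards [this] with v hv
  refine le_trans (Finset.card_le_card ?_) hu
  intro p hp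
  by_contra hc
  exact hv p (Finset.mem_sdiff.mpr ⟨(Finset.mem_filter.mp hp).1, hc⟩) hp

lemma exists_critical (S D : Finset Pt) (m : ℕ) (hLM : ∀ u : Pt, (cL S D u).card ≤ (cM S D u).card)
    {u0 u1 : Pt} (hu0 : u0 ≠ 0) (hu1 : u1 ≠ 0)
    (h0 : (cM S D u0).card ≤ m) (h1 : m + 1 ≤ (cL S D u1).card) :
    ∃ u : Pt, u ≠ 0 ∧ (cL S D u).card ≤ m ∧ m + 1 ≤ (cM S D u).card := by
  by_contra hcon
  push Not at hcon
  have hr : 1 < Module.rank ℝ Pt := by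
    rw [← Module.finrank_eq_rank]
    simp
  have hc : IsPreconnected ({0}ᶜ : Set Pt) :=
    (isConnected_compl_singleton_of_one_lt_rank hr 0).isPreconnected
  obtain ⟨u, _, ha, hb⟩ := hc _ _ (open_M S D m) (open_L S D (m+1)) (by
    intro u hu
    by_cases h : (cL S D u).card ≤ m
    · left
      have := hcon u hu h
      show _ ≤ m
      omega
    · right
      show m + 1 ≤ _
      omega) ⟨u0, hu0, h0⟩ ⟨u1, hu1, h1⟩
  have := hLM u
  simp only [Set.mem_setOf_eq] at ha hb
  omega

lemma crit_edge {k s : ℕ} {P S Q : Finset Pt} (hk : 3 ≤ k) (hks : k + 1 ≤ s) (hP : GenPos P)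
    (hn : 2 * s - 1 ≤ P.card) (hQP : Q ⊆ P) (hQ : Q.card = s) (hSQ : S ⊆ Q) (hS : S.card = k)
    {u0 : Pt} (hu0 : u0 ≠ 0) (hcut : ∀ q ∈ Q, ∀ p ∈ P, p ∉ Q → lf u0 q < lf u0 p) :
    ∃ u : Pt, u ≠ 0 ∧ ∃ C ⊆ P, ∃ y ∈ P, ∃ z ∈ P, C.card = s - 1 ∧ y ∉ C ∧ z ∉ C ∧ y ≠ z ∧
      y ∈ S ∧ S ⊆ insert y C ∧ lf u y = lf u z ∧ (∀ c ∈ C, lf u c < lf u y) ∧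
      (∀ p ∈ P, p ∉ C → lf u y ≤ lf u p) := by
  have hSP : S ⊆ P := hSQ.trans hQP
  have hSne : S.Nonempty := by rw [← Finset.card_pos]; omega
  have hsub : ∀ u, cL S (P \ S) u ⊆ cM S (P \ S) u := by
    intro u p hp
    obtain ⟨a, b, c, d⟩ := Finset.mem_filter.mp hp
    exact Finset.mem_filter.mpr ⟨a, b, c, d.le⟩
  obtain ⟨u, hu, hL, hM⟩ := exists_critical S (P \ S) (s - k)
    (fun u => Finset.card_le_card (hsub u)) hu0 (neg_ne_zero.mpr hu0)
    (by
      have : cM S (P \ S) u0 ⊆ Q \ S := by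
        intro p hp
        obtain ⟨hpD, a, ha, hle⟩ := Finset.mem_filter.mp hp
        rw [Finset.mem_sdiff] at hpD ⊢
        refine ⟨?_, hpD.2⟩
        by_contra hpQ
        exact absurd (hcut a (hSQ ha) p hpD.1 hpQ) (not_lt.mpr hle)
      have := Finset.card_le_card this
      rw [Finset.card_sdiff_of_subset hSQ] at this
      omega)
    (by
      have : P \ Q ⊆ cL S (P \ S) (-u0) := by
        intro p hp
        rw [Finset.mem_sdiff] at hp
        obtain ⟨a, ha⟩ := hSne
        refine Finset.mem_filter.mpr ⟨Finset.mem_sdiff.mpr ⟨hp.1, fun h => hp.2 (hSQ h)⟩, a, ha, ?_⟩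
        rw [lf_neg, lf_neg]
        exact neg_lt_neg (hcut a (hSQ ha) p hp.1 hp.2)
      have := Finset.card_le_card this
      rw [Finset.card_sdiff_of_subset hQP] at this
      omega)
  obtain ⟨y, hyS, hymax⟩ := Finset.exists_max_image S (lf u) hSne
  have hML : (cM S (P \ S) u \ cL S (P \ S) u).Nonempty := by
    rw [← Finset.card_pos, Finset.card_sdiff_of_subset (hsub u)]; omega
  obtain ⟨z, hz⟩ := hML
  have hline : ∀ w, w ∈ cM S (P \ S) u → w ∉ cL S (P \ S) u → w ∈ P ∧ w ∉ S ∧ lf u w = lf u y := by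
    intro w h1 h2
    obtain ⟨hD, a, ha, hle⟩ := Finset.mem_filter.mp h1
    have hD' := Finset.mem_sdiff.mp hD
    refine ⟨hD'.1, hD'.2, le_antisymm (hle.trans (hymax a ha)) ?_⟩
    by_contra hc
    exact h2 (Finset.mem_filter.mpr ⟨hD, y, hyS, not_le.mp hc⟩)
  rw [Finset.mem_sdiff] at hz
  obtain ⟨hzP, hzS, hzy⟩ := hline z hz.1 hz.2
  have hyP := hSP hyS
  have hyz : y ≠ z := fun e => hzS (e ▸ hyS)
  have hone : cM S (P \ S) u ⊆ insert z (cL S (P \ S) u) := by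
    intro w hw
    rw [Finset.mem_insert]
    by_cases hwL : w ∈ cL S (P \ S) u
    · exact Or.inr hwL
    · left
      obtain ⟨a, b, c⟩ := hline w hw hwL
      exact genpos_line hP hu hyP a hzP (fun e => b (e ▸ hyS)) hyz c hzy
  have hLc : (cL S (P \ S) u).card = s - k := by
    have h1 := Finset.card_le_card hone
    rw [Finset.card_insert_of_notMem hz.2] at h1
    omega
  have hSlt : ∀ a ∈ S, a ≠ y → lf u a < lf u y := by
    intro a ha hay
    refine lt_of_le_of_ne (hymax a ha) fun e => ?_
    have := genpos_line hP hu hyP (hSP ha) hzP hay.symm hyz e hzy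
    exact hzS (this ▸ ha)
  have hdisj : Disjoint (S.erase y) (cL S (P \ S) u) := by
    rw [Finset.disjoint_left]
    intro a ha hb
    exact (Finset.mem_sdiff.mp (Finset.mem_filter.mp hb).1).2 (Finset.mem_of_mem_erase ha)
  have hClt : ∀ c ∈ S.erase y ∪ cL S (P \ S) u, lf u c < lf u y := by
    intro c hc
    rcases Finset.mem_union.mp hc with hc | hc
    · exact hSlt c (Finset.mem_of_mem_erase hc) (Finset.ne_of_mem_erase hc)
    · obtain ⟨_, a, ha, hlt⟩ := Finset.mem_filter.mp hc
      exact hlt.trans_le (hymax a ha)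
  refine ⟨u, hu, S.erase y ∪ cL S (P \ S) u, ?_, y, hyP, z, hzP, ?_, ?_, ?_, hyz, hyS, ?_,
    hzy.symm, hClt, ?_⟩
  · intro p hp
    rcases Finset.mem_union.mp hp with hp | hp
    · exact hSP (Finset.mem_of_mem_erase hp)
    · exact (Finset.mem_sdiff.mp (Finset.mem_filter.mp hp).1).1
  · rw [Finset.card_union_of_disjoint hdisj, Finset.card_erase_of_mem hyS]
    omega
  · intro h; exact lt_irrefl _ (hClt y h)
  · intro h
    have := hClt z h
    rw [hzy] at this
    exact lt_irrefl _ this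
  · intro a ha
    by_cases e : a = y
    · simp [e]
    · exact Finset.mem_insert_of_mem (Finset.mem_union_left _ (Finset.mem_erase.mpr ⟨e, ha⟩))
  · intro p hp hpC
    by_contra hc
    apply hpC
    by_cases hpS : p ∈ S
    · refine Finset.mem_union_left _ (Finset.mem_erase.mpr ⟨?_, hpS⟩)
      rintro rfl
      exact hc le_rfl
    · exact Finset.mem_union_right _ (Finset.mem_filter.mpr
        ⟨Finset.mem_sdiff.mpr ⟨hp, hpS⟩, y, hyS, not_le.mp hc⟩)

lemma peel (k s t : ℕ) (hk : 3 ≤ k) (hks : k + 1 ≤ s) (ht : 1 ≤ t)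
    (h2 : ∀ P : Finset Pt, P.card = s → GenPos P → t ≤ numHoles k P)
    (P : Finset Pt) (hP : GenPos P) (hn : 2 * s - 1 ≤ P.card) :
    ∃ R ⊆ P, R.card = s - k + 1 ∧ numHoles k (P \ R) + (t + 1) ≤ numHoles k P := by
  obtain ⟨u0, hu0, hgen⟩ := exists_generic P
  obtain ⟨Q, hQP, hQ, hQf⟩ := exists_first (lf u0) P s (by omega)
  have hcut : ∀ q ∈ Q, ∀ p ∈ P, p ∉ Q → lf u0 q < lf u0 p := by
    intro q hq p hp hpQ
    refine lt_of_le_of_ne (hQf q hq p hp hpQ) fun e => hpQ ?_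
    rw [← hgen q (hQP hq) p hp e]; exact hq
  have hpos : 0 < numHoles k Q := lt_of_lt_of_le ht (h2 Q hQ (hP.mono hQP))
  obtain ⟨S, hS⟩ := Finset.card_pos.mp hpos
  have hSQ : IsHole k Q S := (Finset.mem_filter.mp hS).2
  have hSP : IsHole k P S := hole_lift_cut hP hu0 hQP hSQ
    (fun x hx hxQ q hq => (hcut q hq x hx hxQ).le)
  obtain ⟨u, hu, C, hCP, y, hy, z, hz, hCc, hyC, hzC, hyz, hyS, hSC, hfyz, hClt, hCge⟩ :=
    crit_edge hk hks hP hn hQP hQ hSQ.1 hSQ.2.1 hu0 hcut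
  obtain ⟨R, hRC, hRc, hRf⟩ := exists_first (lf u) C (s - k + 1) (by omega)
  have hRP := hRC.trans hCP
  have hQ'P : insert z C ⊆ P := Finset.insert_subset hz hCP
  have hQ'c : (insert z C).card = s := by rw [Finset.card_insert_of_notMem hzC]; omega
  have hCR : (C \ R).card = k - 2 := by rw [Finset.card_sdiff_of_subset hRC]; omega
  refine ⟨R, hRP, hRc, ?_⟩
  set H1 := (P \ R).powerset.filter (fun S => IsHole k (P \ R) S) with hH1
  set H2 := (insert z C).powerset.filter (fun S => IsHole k (insert z C) S) with hH2
  have hSH2 : S ∉ H2 := by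
    intro h
    have := (Finset.mem_filter.mp h).2.1 hyS
    rcases Finset.mem_insert.mp this with h | h
    · exact hyz h
    · exact hyC h
  have hH2t : t ≤ H2.card := h2 _ hQ'c (hP.mono hQ'P)
  have hmeet : ∀ w : Pt, ∀ T : Finset Pt, T ⊆ insert w C → T.card = k → ¬ T ⊆ P \ R := by
    intro w T hT hTk hTR
    have : T ⊆ insert w (C \ R) := by
      intro a ha
      rcases Finset.mem_insert.mp (hT ha) with h | h
      · simp [h]
      · exact Finset.mem_insert_of_mem (Finset.mem_sdiff.mpr ⟨h, (Finset.mem_sdiff.mp (hTR ha)).2⟩)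
    have := (Finset.card_le_card this).trans (Finset.card_insert_le _ _)
    omega
  have hdisj : Disjoint H1 (insert S H2) := by
    rw [Finset.disjoint_left]
    intro T hT1 hT2
    have hT := (Finset.mem_filter.mp hT1).2
    rcases Finset.mem_insert.mp hT2 with rfl | hT2
    · exact hmeet y T hSC hT.2.1 hT.1
    · exact hmeet z T (Finset.mem_filter.mp hT2).2.1 hT.2.1 hT.1
  have hsub : H1 ∪ insert S H2 ⊆ P.powerset.filter (fun S => IsHole k P S) := by
    intro T hT
    have : IsHole k P T := by
      rcases Finset.mem_union.mp hT with hT | hT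
      · have hT := (Finset.mem_filter.mp hT).2
        refine hole_lift Finset.sdiff_subset hT fun x hx hxR => ?_
        have hxR' : x ∈ R := by
          by_contra h
          exact hxR (Finset.mem_sdiff.mpr ⟨hx, h⟩)
        refine key hP hu hx (hT.1.trans Finset.sdiff_subset) (fun e => hxR (hT.1 e)) ?_
        intro a ha
        have ha' := Finset.mem_sdiff.mp (hT.1 ha)
        by_cases haC : a ∈ C
        · exact hRf x hxR' a haC ha'.2
        · exact (hClt x (hRC hxR')).le.trans (hCge a ha'.1 haC)
      · rcases Finset.mem_insert.mp hT with rfl | hT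
        · exact hSP
        · have hT := (Finset.mem_filter.mp hT).2
          refine hole_lift_cut hP hu hQ'P hT fun x hx hxQ q hq => ?_
          have h1 := hCge x hx (fun h => hxQ (Finset.mem_insert_of_mem h))
          rcases Finset.mem_insert.mp hq with rfl | hq
          · rw [← hfyz]; exact h1
          · exact (hClt q hq).le.trans h1
    exact Finset.mem_filter.mpr ⟨Finset.mem_powerset.mpr this.1, this⟩
  have hfin := Finset.card_le_card hsub
  rw [Finset.card_union_of_disjoint hdisj, Finset.card_insert_of_notMem hSH2] at hfin
  have e1 : numHoles k (P \ R) = H1.card := rfl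
  have e2 : numHoles k P = (P.powerset.filter (fun S => IsHole k P S)).card := rfl
  omega

/-- if `X_k(s−1) ≥ 1` and `X_k(s) ≥ t`, then
`X_k(n) ≥ (t+1)/(s−k+1) · (n − (2s−2))` for all `n ≥ 2s−2`. -/
theorem stmt_2 (k s t : ℕ) (hk : 3 ≤ k) (hks : k + 1 ≤ s) (ht : 1 ≤ t)
    (h1 : ∀ P : Finset Pt, P.card = s - 1 → GenPos P → 1 ≤ numHoles k P)
    (h2 : ∀ P : Finset Pt, P.card = s → GenPos P → t ≤ numHoles k P) :
    ∀ n : ℕ, 2 * s - 2 ≤ n → ∀ P : Finset Pt, P.card = n → GenPos P →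
      ((t : ℝ) + 1) / ((s : ℝ) - k + 1) * ((n : ℝ) - (2 * s - 2)) ≤ (numHoles k P : ℝ) := by
  have hks' : (k : ℝ) + 1 ≤ s := by exact_mod_cast hks
  have hd : (0 : ℝ) < (s : ℝ) - k + 1 := by linarith
  suffices H : ∀ n : ℕ, ∀ P : Finset Pt, P.card = n → GenPos P →
      ((t : ℝ) + 1) / ((s : ℝ) - k + 1) * ((n : ℝ) - (2 * s - 2)) ≤ (numHoles k P : ℝ) from
    fun n _ => H n
  intro n
  induction n using Nat.strong_induction_on with
  | _ n ih =>
    intro P hPn hP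
    by_cases hn : 2 * s - 1 ≤ n
    · obtain ⟨R, hRP, hRc, hle⟩ := peel k s t hk hks ht h2 P hP (by omega)
      have hc : (P \ R).card = n - (s - k + 1) := by
        rw [Finset.card_sdiff_of_subset hRP]; omega
      have := ih (n - (s - k + 1)) (by omega) (P \ R) hc (hP.mono Finset.sdiff_subset)
      have hcast : ((n - (s - k + 1) : ℕ) : ℝ) = (n : ℝ) - ((s : ℝ) - k + 1) := by
        rw [Nat.cast_sub (by omega)]
        push_cast [Nat.cast_sub (show k ≤ s by omega)]
        ring
      rw [hcast] at this
      have hle' : (numHoles k (P \ R) : ℝ) + (t + 1) ≤ numHoles k P := by exact_mod_cast hle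
      have e : ((t : ℝ) + 1) / ((s : ℝ) - k + 1) * ((n : ℝ) - (2 * s - 2)) =
        ((t : ℝ) + 1) / ((s : ℝ) - k + 1) * ((n : ℝ) - ((s : ℝ) - k + 1) - (2 * s - 2))
          + (t + 1) := by
        field_simp
        ring
      rw [e]
      linarith
    · have h3 : (n : ℝ) + 2 ≤ 2 * s := by
        have : n + 2 ≤ 2 * s := by omega
        exact_mod_cast this
      refine le_trans (mul_nonpos_of_nonneg_of_nonpos (by positivity) (by linarith)) (by positivity)
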